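/- Let γ=(γ_n)_{n≥1} be nonnegative reals with finite support whose three smallest elements are p<q<r (so γ_p>0, γ_q>0, γ_r>0), and set Γ = ∑_{n≥r} γ_n. If q·ω_p^{(4)}(γ) = p·ω_q^{(4)}(γ) and r·ω_p^{(4)}(γ) = p·ω_r^{(4)}(γ), then (r − p + 2γ_q)·Γ = (r−p)·(p+q+r)/3 + (p+q)·γ_q − γ_q². Consequently, if γ_q < (p+q)/3 then Γ > (p+q)/3. -/

import Mathlib

/-- The frequencies `ω_n^{(4)}` of the third-order Benjamin–Ono equation, in terms of
the actions `γ_p` (indexed by `p ≥ 1`; terms with index `0` carry a zero factor, so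
summing over `ℕ` is the same as summing over indices `≥ 1`):
`ω_n^{(4)}(γ) = n³ + n ∑_{p≥1} p γ_p − 3 ∑_{p≥1} min(p,n)² γ_p
  + 3 ∑_{p,q≥1} min(p,q,n) γ_p γ_q`. -/
noncomputable def omega4 (γ : ℕ → ℝ) (n : ℕ) : ℝ :=
  (n : ℝ) ^ 3 + (n : ℝ) * (∑' p : ℕ, (p : ℝ) * γ p)
    - 3 * (∑' p : ℕ, ((min p n : ℕ) : ℝ) ^ 2 * γ p)
    + 3 * (∑' pq : ℕ × ℕ, ((min (min pq.1 pq.2) n : ℕ) : ℝ) * γ pq.1 * γ pq.2)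

/-- For `γ` supported in the finite set `s`, the series in `omega4 γ n` are sums over `s`. -/
theorem omega4_eq_sum (γ : ℕ → ℝ) (s : Finset ℕ) (hs : ∀ m, m ∉ s → γ m = 0) (n : ℕ) :
    omega4 γ n = (n : ℝ) ^ 3 + (n : ℝ) * (∑' m : ℕ, (m : ℝ) * γ m)
      - 3 * (∑ m ∈ s, ((min m n : ℕ) : ℝ) ^ 2 * γ m)
      + 3 * (∑ i ∈ s, ∑ j ∈ s, ((min (min i j) n : ℕ) : ℝ) * γ i * γ j) := by
  rw [omega4, tsum_eq_sum (s := s) (f := fun m : ℕ => ((min m n : ℕ) : ℝ) ^ 2 * γ m)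
      (fun m hm => by simp [hs m hm]),
    tsum_eq_sum (s := s ×ˢ s)
      (f := fun x : ℕ × ℕ => ((min (min x.1 x.2) n : ℕ) : ℝ) * γ x.1 * γ x.2) ?_,
    Finset.sum_product]
  rintro ⟨i, j⟩ hij
  rw [Finset.mem_product, not_and_or] at hij
  rcases hij with h | h <;> simp [hs _ h]

/-- If on `s` the truncation `min m n` only takes the values `x`, `y`, `z`, according to the
position of `m` relative to `q ≤ r`, then `omega4 γ n` is a polynomial in the tail masses. -/
theorem omega4_eq_tails (γ : ℕ → ℝ) (s : Finset ℕ) (hs : ∀ m, m ∉ s → γ m = 0)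
    (q r n x y z : ℕ) (hqr : q ≤ r) (hxy : x ≤ y) (hyz : y ≤ z)
    (hx : ∀ m ∈ s, m < q → min m n = x) (hy : ∀ m ∈ s, q ≤ m → m < r → min m n = y)
    (hz : ∀ m ∈ s, r ≤ m → min m n = z) :
    omega4 γ n = (n : ℝ) ^ 3 + (n : ℝ) * (∑' m : ℕ, (m : ℝ) * γ m)
      - 3 * ((x : ℝ) ^ 2 * (∑ m ∈ s, γ m)
        + ((y : ℝ) ^ 2 - (x : ℝ) ^ 2) * (∑ m ∈ s, if q ≤ m then γ m else 0)
        + ((z : ℝ) ^ 2 - (y : ℝ) ^ 2) * (∑ m ∈ s, if r ≤ m then γ m else 0))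
      + 3 * ((x : ℝ) * (∑ m ∈ s, γ m) ^ 2
        + ((y : ℝ) - x) * (∑ m ∈ s, if q ≤ m then γ m else 0) ^ 2
        + ((z : ℝ) - y) * (∑ m ∈ s, if r ≤ m then γ m else 0) ^ 2) := by
  have trichotomy : ∀ m ∈ s, (m < q ∧ m < r ∧ min m n = x) ∨
      (q ≤ m ∧ m < r ∧ min m n = y) ∨ (q ≤ m ∧ r ≤ m ∧ min m n = z) := by
    intro m hm
    rcases lt_or_ge m q with h | h
    · exact Or.inl ⟨h, by omega, hx m hm h⟩
    · rcases lt_or_ge m r with h' | h'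
      · exact Or.inr (Or.inl ⟨h, h', hy m hm h h'⟩)
      · exact Or.inr (Or.inr ⟨h, h', hz m hm h'⟩)
  rw [omega4_eq_sum γ s hs n]
  congr 2
  · congr 1
    simp only [Finset.mul_sum, ← Finset.sum_add_distrib]
    refine Finset.sum_congr rfl fun m hm => ?_
    rcases trichotomy m hm with ⟨h, h', e⟩ | ⟨h, h', e⟩ | ⟨h, h', e⟩ <;>
      simp only [e, h, h', not_le.mpr, if_true, if_false] <;> ring
  · simp only [sq, Finset.sum_mul_sum]
    simp only [Finset.mul_sum, ← Finset.sum_add_distrib]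
    refine Finset.sum_congr rfl fun i hi => Finset.sum_congr rfl fun j hj => ?_
    have e : min (min i j) n = min (min i n) (min j n) := by omega
    rw [e]
    rcases trichotomy i hi with ⟨h, h', e⟩ | ⟨h, h', e⟩ | ⟨h, h', e⟩ <;>
      rcases trichotomy j hj with ⟨k, k', f⟩ | ⟨k, k', f⟩ | ⟨k, k', f⟩ <;>
      simp only [e, f, h, h', k, k', not_le.mpr, if_true, if_false, min_self, min_eq_left,
        min_eq_right, hxy, hyz, hxy.trans hyz] <;> ring

/-- if `γ` has finite support whose three smallest elements are `p < q < r`,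
and the speeds of the modes `p, q, r` agree, then with `Γ = ∑_{n≥r} γ_n` one has
`(r − p + 2γ_q)Γ = (r−p)(p+q+r)/3 + (p+q)γ_q − γ_q²`; consequently, if
`γ_q < (p+q)/3` then `Γ > (p+q)/3`. -/
theorem threeSmallest_speed_eq (γ : ℕ → ℝ) (hγ : ∀ n, 0 ≤ γ n) (h0 : γ 0 = 0)
    (hfin : (Function.support γ).Finite)
    (p q r : ℕ) (hp : γ p ≠ 0) (hq : γ q ≠ 0) (hr : γ r ≠ 0)
    (hpq : p < q) (hqr : q < r)
    (hmin : ∀ n, γ n ≠ 0 → n = p ∨ n = q ∨ r ≤ n)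
    (h1 : (q : ℝ) * omega4 γ p = (p : ℝ) * omega4 γ q)
    (h2 : (r : ℝ) * omega4 γ p = (p : ℝ) * omega4 γ r) :
    ((r : ℝ) - p + 2 * γ q) * (∑' n : ℕ, if r ≤ n then γ n else 0)
        = ((r : ℝ) - p) * ((p : ℝ) + q + r) / 3 + ((p : ℝ) + q) * γ q - γ q ^ 2 ∧
      (γ q < ((p : ℝ) + q) / 3 →
        ((p : ℝ) + q) / 3 < ∑' n : ℕ, if r ≤ n then γ n else 0) := by
  set s := hfin.toFinset with hs_def
  have mem_s : ∀ m, m ∈ s ↔ γ m ≠ 0 := fun m => by simp [hs_def]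
  have hs : ∀ m, m ∉ s → γ m = 0 := fun m hm => by simpa [mem_s] using hm
  have hmin' : ∀ m ∈ s, m = p ∨ m = q ∨ r ≤ m := fun m hm => hmin m ((mem_s m).1 hm)
  have tail_r : (∑' n : ℕ, if r ≤ n then γ n else 0) = ∑ m ∈ s, if r ≤ m then γ m else 0 :=
    tsum_eq_sum fun m hm => by simp [hs m hm]
  have tail_q : (∑ m ∈ s, if q ≤ m then γ m else 0)
      = γ q + ∑ m ∈ s, if r ≤ m then γ m else 0 := by
    have : γ q = ∑ m ∈ s, if m = q then γ m else 0 := by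
      rw [Finset.sum_ite_eq' s q γ, if_pos ((mem_s q).2 hq)]
    rw [this, ← Finset.sum_add_distrib]
    refine Finset.sum_congr rfl fun m hm => ?_
    have := hmin' m hm
    split_ifs <;> first | omega | simp
  have total : ∑ m ∈ s, γ m = γ p + ∑ m ∈ s, if q ≤ m then γ m else 0 := by
    have : γ p = ∑ m ∈ s, if m = p then γ m else 0 := by
      rw [Finset.sum_ite_eq' s p γ, if_pos ((mem_s p).2 hp)]
    rw [this, ← Finset.sum_add_distrib]
    refine Finset.sum_congr rfl fun m hm => ?_
    have := hmin' m hm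
    split_ifs <;> first | omega | simp
  have speed_p := omega4_eq_tails γ s hs q r p p p p hqr.le le_rfl le_rfl
    (fun m hm _ => by have := hmin' m hm; omega) (fun m hm _ _ => by omega)
    (fun m hm _ => by omega)
  have speed_q := omega4_eq_tails γ s hs q r q p q q hqr.le hpq.le le_rfl
    (fun m hm _ => by have := hmin' m hm; omega) (fun m hm _ _ => by omega)
    (fun m hm _ => by omega)
  have speed_r := omega4_eq_tails γ s hs q r r p q r hqr.le hpq.le hqr.le
    (fun m hm _ => by have := hmin' m hm; omega)
    (fun m hm _ _ => by have := hmin' m hm; omega) (fun m hm _ => by omega)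
  rw [total, tail_q] at speed_p speed_q speed_r
  rw [speed_p, speed_q] at h1
  rw [speed_p, speed_r] at h2
  rw [tail_r]
  generalize (∑ m ∈ s, if r ≤ m then γ m else 0) = G at *
  generalize (∑' m : ℕ, (m : ℝ) * γ m) = P at *
  have p_pos : (0 : ℝ) < p := by
    exact_mod_cast Nat.pos_of_ne_zero fun h : p = 0 => hp (by rw [h, h0])
  have q_sub_p : (0 : ℝ) < (q : ℝ) - p := sub_pos.2 (by exact_mod_cast hpq)
  have r_sub_q : (0 : ℝ) < (r : ℝ) - q := sub_pos.2 (by exact_mod_cast hqr)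
  have q_pos : 0 < γ q := (hγ q).lt_of_ne' hq
  have first_eq : 3 * (γ p ^ 2 + 2 * γ p * (γ q + G))
      = q * ((p : ℝ) + q) + 3 * p * γ p - 3 * q * (γ q + G) := by
    refine mul_left_cancel₀ (mul_pos p_pos q_sub_p).ne' ?_
    linear_combination h1
  have main_eq : ((r : ℝ) - p + 2 * γ q) * G
      = ((r : ℝ) - p) * ((p : ℝ) + q + r) / 3 + ((p : ℝ) + q) * γ q - γ q ^ 2 := by
    refine mul_left_cancel₀ (mul_pos p_pos r_sub_q).ne' ?_
    linear_combination h2 / 3 - (p : ℝ) * ((r : ℝ) - p) / 3 * first_eq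
  refine ⟨main_eq, fun hlt => ?_⟩
  have factor_pos : 0 < (r : ℝ) - p + 2 * γ q := by linarith
  refine lt_of_mul_lt_mul_left ?_ factor_pos.le
  have r_term : 0 < ((r : ℝ) - p) * r := mul_pos (by linarith) (by linarith)
  have q_term : 0 < γ q * (((p : ℝ) + q) / 3 - γ q) := mul_pos q_pos (sub_pos.2 hlt)
  rw [main_eq]
  linarith
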